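/- arXiv:2004.00574 — 2 statements merged into one kernel-verified Lean document; each statement's English description precedes it below -/
import Mathlib

section
/- There exist real numbers ω and φ such that for every natural number t, the square-wave value (1 if t mod 4 ∈ {0, 1}, and 0 otherwise) equals f(cos(ωt + φ)), where f : ℝ → ℝ is defined by f(x) = 1 if x > 0 and f(x) = 0 otherwise. In particular ω = π/2 and φ = −π/4 work. -/
open Real

/-- The nonlinearity `f(x) = 1` if `x > 0` and `0` otherwise. -/
noncomputable def stepFn (x : ℝ) : ℝ := if x > 0 then 1 else 0

/-- The square wave: `1` if `t mod 4 ∈ {0, 1}` and `0` otherwise. -/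
def squareWave (t : ℕ) : ℝ := if t % 4 = 0 ∨ t % 4 = 1 then 1 else 0

theorem cos_pi_div_two_mul_sub_pi_div_four (q r : ℕ) :
    Real.cos (π / 2 * ((4 * q + r : ℕ) : ℝ) + -(π / 4)) = Real.cos (π / 2 * r - π / 4) := by
  rw [← Real.cos_add_nat_mul_two_pi (π / 2 * r - π / 4) q]
  congr 1
  push_cast
  ring

/-- Infinite data lemma: the square wave, whose Fourier expansion requires infinitely
many modes, can be modeled exactly with a single frequency composed with a simple
nonlinear function: there exist `ω` and `φ` such that the square wave equals
`f(cos(ωt + φ))` for all natural `t`. -/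
theorem squareWave_single_frequency_nonlinear :
    ∃ ω φ : ℝ, ∀ t : ℕ, squareWave t = stepFn (Real.cos (ω * (t : ℝ) + φ)) := by
  refine ⟨π / 2, -(π / 4), fun t => ?_⟩
  have hπ := Real.pi_pos
  have hcos := cos_pi_div_two_mul_sub_pi_div_four (t / 4) (t % 4)
  rw [Nat.div_add_mod] at hcos
  rw [squareWave, stepFn, hcos]
  by_cases h : t % 4 = 0 ∨ t % 4 = 1
  · have hpos : 0 < Real.cos (π / 2 * (t % 4 : ℕ) - π / 4) := by
      apply Real.cos_pos_of_mem_Ioo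
      rcases h with h | h <;> rw [h] <;> push_cast <;> constructor <;> linarith
    rw [if_pos h, if_pos hpos]
  · have hneg : Real.cos (π / 2 * (t % 4 : ℕ) - π / 4) < 0 := by
      have h' : t % 4 = 2 ∨ t % 4 = 3 := by omega
      apply Real.cos_neg_of_pi_div_two_lt_of_lt <;>
        rcases h' with h' | h' <;> rw [h'] <;> push_cast <;> linarith
    rw [if_neg h, if_neg hneg.not_gt]
end

section
/- Let m be a positive integer and for ω ∈ ℝ^m and t ∈ ℝ define Ω(ωt) = (cos(ω_1 t), ..., cos(ω_m t), sin(ω_1 t), ..., sin(ω_m t)) ∈ ℝ^{2m}, equipped with the sup norm. Let f : ℝ^{2m} → ℝ be Lipschitz continuous with constant λ ≥ 0 with respect to the sup norm. Let σ > 0, T > 0 be real numbers, A ∈ ℝ^m with A_i > 0 for all i, and suppose ω, ω* ∈ ℝ^m satisfy |ω_i − ω_i*| ≤ (σ²/A_i)·√(48/T³) for every i ∈ {1,...,m}. Then for all t ≥ 0, |f(Ω(ωt)) − f(Ω(ω*t))| ≤ λ · t · (√48 · σ² / √(T³)) · Σ_{i=1}^{m} 1/A_i. -/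
open Real Finset

/-- The oscillator vector `Ω(ωt) = (cos(ω₁t), ..., cos(ω_m t), sin(ω₁t), ..., sin(ω_m t))`,
viewed as an element of `ℝ^{2m}` indexed by `Fin m ⊕ Fin m` (the Pi norm is the sup norm). -/
noncomputable def OmegaVec (m : ℕ) (ω : Fin m → ℝ) (t : ℝ) : (Fin m ⊕ Fin m) → ℝ :=
  Sum.elim (fun i => Real.cos (ω i * t)) (fun i => Real.sin (ω i * t))

/-- In the sup norm, `OmegaVec` at time `t` is `|t|`-Lipschitz in the frequencies. -/
theorem norm_OmegaVec_sub_le (m : ℕ) (ω ω' : Fin m → ℝ) (t : ℝ) :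
    ‖OmegaVec m ω t - OmegaVec m ω' t‖ ≤ |t| * ‖ω - ω'‖ := by
  have key (i : Fin m) : |ω i * t - ω' i * t| ≤ |t| * ‖ω - ω'‖ := by
    rw [← sub_mul, abs_mul, mul_comm]
    gcongr
    exact norm_le_pi_norm (ω - ω') i
  refine (pi_norm_le_iff_of_nonneg (by positivity)).2 ?_
  rintro (i | i)
  · exact (Real.abs_cos_sub_cos_le _ _).trans (key i)
  · exact (Real.abs_sin_sub_sin_le _ _).trans (key i)

/-- Linear-in-time error bounds: if `f : ℝ^{2m} → ℝ` is Lipschitz with constant `λ ≥ 0`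
(sup norm) and each frequency `ωᵢ` is resolved within one standard deviation
`(σ²/Aᵢ)√(48/T³)` of the true frequency `ωᵢ*`, then for all `t ≥ 0`,
`|f(Ω(ωt)) − f(Ω(ω*t))| ≤ λ t (√48 σ² / √(T³)) ∑ᵢ 1/Aᵢ`. -/
theorem linear_in_time_error_bound
    (m : ℕ) (hm : 0 < m) (lam : ℝ) (hlam : 0 ≤ lam)
    (f : ((Fin m ⊕ Fin m) → ℝ) → ℝ)
    (hf : ∀ u v : (Fin m ⊕ Fin m) → ℝ, |f u - f v| ≤ lam * ‖u - v‖)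
    (σ T : ℝ) (hσ : 0 < σ) (hT : 0 < T)
    (A : Fin m → ℝ) (hA : ∀ i, 0 < A i)
    (ω ωs : Fin m → ℝ)
    (hres : ∀ i, |ω i - ωs i| ≤ (σ ^ 2 / A i) * Real.sqrt (48 / T ^ 3))
    (t : ℝ) (ht : 0 ≤ t) :
    |f (OmegaVec m ω t) - f (OmegaVec m ωs t)| ≤
      lam * t * (Real.sqrt 48 * σ ^ 2 / Real.sqrt (T ^ 3)) * ∑ i : Fin m, 1 / A i := by
  have hsqrt : Real.sqrt (48 / T ^ 3) = Real.sqrt 48 / Real.sqrt (T ^ 3) :=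
    Real.sqrt_div (by norm_num) _
  have hinv (i : Fin m) : 0 ≤ 1 / A i := (one_div_pos.2 (hA i)).le
  have hω : ‖ω - ωs‖ ≤ Real.sqrt 48 * σ ^ 2 / Real.sqrt (T ^ 3) * ∑ i : Fin m, 1 / A i := by
    refine (pi_norm_le_iff_of_nonneg
      (mul_nonneg (by positivity) (sum_nonneg fun i _ => hinv i))).2 fun i => ?_
    calc |ω i - ωs i| ≤ (σ ^ 2 / A i) * Real.sqrt (48 / T ^ 3) := hres i
      _ = Real.sqrt 48 * σ ^ 2 / Real.sqrt (T ^ 3) * (1 / A i) := by rw [hsqrt]; ring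
      _ ≤ _ := by
        gcongr
        exact single_le_sum (f := fun i => 1 / A i) (fun i _ => hinv i) (mem_univ i)
  calc |f (OmegaVec m ω t) - f (OmegaVec m ωs t)|
      ≤ lam * ‖OmegaVec m ω t - OmegaVec m ωs t‖ := hf _ _
    _ ≤ lam * (|t| * ‖ω - ωs‖) := by gcongr; exact norm_OmegaVec_sub_le m ω ωs t
    _ ≤ lam * (t * (Real.sqrt 48 * σ ^ 2 / Real.sqrt (T ^ 3) * ∑ i : Fin m, 1 / A i)) := by
        rw [abs_of_nonneg ht]; gcongr
    _ = _ := by ring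
end
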